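/- Let F be a one-step skew product satisfying conditions (H0), (H1), (H2), and let φ : [0,1] → ℝ be a monotonically increasing function. Then there exist constants ū, ℓ̄ ∈ ℝ such that for every x ∈ (0,1) and for ℙ-almost every ω ∈ Ω: limsup_{n→∞} (1/n)∑_{j=0}^{n-1} φ(f_ω^j(x)) = ū and liminf_{n→∞} (1/n)∑_{j=0}^{n-1} φ(f_ω^j(x)) = ℓ̄. -/

import Mathlib

open MeasureTheory Filter Set

noncomputable section

/-- Fiber compositions of a one-step skew product:
`fib f ω n = f_{ω_{n-1}} ∘ ⋯ ∘ f_{ω_0}`. -/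
def fib {𝒜 : Type*} (f : 𝒜 → ℝ → ℝ) (ω : ℕ → 𝒜) : ℕ → ℝ → ℝ
  | 0 => id
  | n + 1 => f (ω n) ∘ fib f ω n

/-- `ℙ` is the Bernoulli product measure `p^ℕ` on `𝒜^ℕ`, characterized by its values on
cylinder sets. -/
def IsBernoulli {𝒜 : Type*} [MeasurableSpace 𝒜] (p : Measure 𝒜) (ℙ : Measure (ℕ → 𝒜)) : Prop :=
  ∀ (n : ℕ) (s : Fin n → Set 𝒜), (∀ i, MeasurableSet (s i)) →
    ℙ {ω : ℕ → 𝒜 | ∀ i : Fin n, ω (i : ℕ) ∈ s i} = ∏ i, p (s i)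

/-- The tail σ-algebra generated by the real random variables `X m, X (m+1), …`
is `ℙ`-trivial. -/
def TailTrivial {Ω : Type*} [MeasurableSpace Ω] (ℙ : Measure Ω) (X : ℕ → Ω → ℝ) : Prop :=
  ∀ s : Set Ω,
    MeasurableSet[⨅ m : ℕ, ⨆ (n : ℕ) (_ : m ≤ n),
      MeasurableSpace.comap (X n) (inferInstance : MeasurableSpace ℝ)] s →
    ℙ s = 0 ∨ ℙ s = 1


lemma liminf_eq_neg (a : ℕ → ℝ) : liminf a atTop = - limsup (fun n => - a n) atTop := by
  rw [limsup_eq, liminf_eq, Real.sInf_def, neg_neg]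
  congr 1
  ext c
  simp

lemma bdd_le {a : ℕ → ℝ} {C : ℝ} (h : ∀ n, |a n| ≤ C) :
    IsBoundedUnder (· ≤ ·) atTop a := ⟨C, by simpa using ⟨0, fun n _ => (abs_le.1 (h n)).2⟩⟩

lemma bdd_ge {a : ℕ → ℝ} {C : ℝ} (h : ∀ n, |a n| ≤ C) :
    IsBoundedUnder (· ≥ ·) atTop a := ⟨-C, by simpa using ⟨0, fun n _ => (abs_le.1 (h n)).1⟩⟩

lemma limsup_le_of_sub {a b : ℕ → ℝ} {C : ℝ} (ha : ∀ n, |a n| ≤ C) (hb : ∀ n, |b n| ≤ C)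
    (h : Tendsto (fun n => a n - b n) atTop (nhds 0)) : limsup a atTop ≤ limsup b atTop := by
  apply le_of_forall_pos_le_add
  intro ε hε
  rw [← limsup_add_const atTop b ε (bdd_le hb) (bdd_ge hb).isCoboundedUnder_le]
  refine limsup_le_limsup ?_ (bdd_ge ha).isCoboundedUnder_le ?_
  · filter_upwards [h.eventually (gt_mem_nhds hε)] with n hn
    linarith
  · refine bdd_le (C := C + ε) fun n => ?_
    calc |b n + ε| ≤ |b n| + |ε| := abs_add_le _ _
      _ ≤ C + ε := by rw [abs_of_pos hε]; linarith [hb n]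

/-- Averages. -/
def avg (y : ℕ → ℝ) (n : ℕ) : ℝ := (n:ℝ)⁻¹ * ∑ j ∈ Finset.range n, y j

lemma abs_sum_le {y : ℕ → ℝ} {C : ℝ} (h : ∀ n, |y n| ≤ C) (n : ℕ) :
    |∑ j ∈ Finset.range n, y j| ≤ n * C := by
  refine (Finset.abs_sum_le_sum_abs _ _).trans ((Finset.sum_le_sum fun i _ => h i).trans ?_)
  simp

lemma abs_avg_le {y : ℕ → ℝ} {C : ℝ} (h : ∀ n, |y n| ≤ C) (n : ℕ) : |avg y n| ≤ C := by
  have hC : 0 ≤ C := (abs_nonneg _).trans (h 0)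
  rcases Nat.eq_zero_or_pos n with rfl | hn
  · simpa [avg] using hC
  have hn' : (0:ℝ) < n := by exact_mod_cast hn
  rw [avg, abs_mul, abs_of_pos (inv_pos.2 hn'), inv_mul_le_iff₀ hn']
  exact abs_sum_le h n

lemma limsup_avg_succ {y : ℕ → ℝ} {C : ℝ} (h : ∀ n, |y n| ≤ C) :
    limsup (avg y) atTop = limsup (avg fun n => y (n + 1)) atTop := by
  have h' : ∀ n, |y (n+1)| ≤ C := fun n => h (n+1)
  rw [← limsup_nat_add (avg y) 1]
  have key : Tendsto (fun n => avg y (n+1) - avg (fun n => y (n+1)) n) atTop (nhds 0) := by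
    refine squeeze_zero_norm' (a := fun n : ℕ => 2 * C / (n:ℝ)) ?_ ?_
    · filter_upwards [eventually_gt_atTop 0] with n hn
      have hn' : (0:ℝ) < n := by exact_mod_cast hn
      have e : avg y (n+1) - avg (fun n => y (n+1)) n
          = (n + 1 : ℝ)⁻¹ * (y 0 - avg (fun n => y (n+1)) n) := by
        simp only [avg, Finset.sum_range_succ']
        push_cast
        field_simp
        ring
      rw [e, Real.norm_eq_abs, abs_mul, abs_of_pos (by positivity), div_eq_inv_mul]
      have h1 : |y 0 - avg (fun n => y (n+1)) n| ≤ 2 * C := by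
        refine (abs_sub _ _).trans ?_
        linarith [h 0, abs_avg_le h' n]
      gcongr
      linarith
    · exact tendsto_const_div_atTop_nhds_zero_nat _
  apply le_antisymm
  · exact limsup_le_of_sub (fun n => abs_avg_le h (n+1)) (abs_avg_le h') key
  · refine limsup_le_of_sub (abs_avg_le h') (fun n => abs_avg_le h (n+1)) ?_
    simpa using key.neg

lemma limsup_avg_add {y : ℕ → ℝ} {C : ℝ} (h : ∀ n, |y n| ≤ C) (m : ℕ) :
    limsup (avg y) atTop = limsup (avg fun n => y (n + m)) atTop := by
  induction m with
  | zero => rfl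
  | succ m ih =>
    rw [ih, limsup_avg_succ (fun n => h (n+m))]
    congr 2
    ext n
    congr 1
    ring

lemma meas_limsup {Ω : Type*} [MeasurableSpace Ω] (Y : ℕ → Ω → ℝ) {C : ℝ}
    (hC : ∀ n ω, |Y n ω| ≤ C) (m : ℕ) (hY : ∀ n, m ≤ n → Measurable (Y n)) :
    Measurable fun ω => limsup (avg fun n => Y n ω) atTop := by
  have : (fun ω => limsup (avg fun n => Y n ω) atTop)
      = fun ω => limsup (fun k => avg (fun n => Y (n+m) ω) k) atTop := by
    ext ω
    exact limsup_avg_add (fun n => hC n ω) m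
  rw [this]
  refine Measurable.limsup fun k => ?_
  unfold avg
  exact (Finset.measurable_sum _ fun i _ => hY _ (by omega)).const_mul _

lemma bern_pi {𝒜 : Type*} [MeasurableSpace 𝒜] {p : Measure 𝒜} [IsProbabilityMeasure p]
    {ℙ : Measure (ℕ → 𝒜)} (hPr : IsBernoulli p ℙ) (s : Finset ℕ) (t : ℕ → Set 𝒜)
    (ht : ∀ i, MeasurableSet (t i)) : ℙ (Set.pi s t) = ∏ i ∈ s, p (t i) := by
  classical
  obtain ⟨N, hN⟩ : ∃ N, s ⊆ Finset.range N := s.exists_nat_subset_range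
  have := hPr N (fun i => if (i:ℕ) ∈ s then t i else univ) (fun i => by
    split_ifs; exacts [ht _, MeasurableSet.univ])
  rw [Fin.prod_univ_eq_prod_range (fun i => p (if i ∈ s then t i else univ)) N] at this
  rw [← Finset.prod_subset hN (f := fun i => p (if i ∈ s then t i else univ))] at this
  · rw [Finset.prod_congr rfl (g := fun i => p (t i))] at this
    · rw [← this]
      congr 1
      ext ω
      simp only [Set.mem_pi, Finset.mem_coe, Set.mem_ofPred_eq]
      constructor
      · intro h i
        split_ifs with hi
        exacts [h _ hi, trivial]
      · intro h i hi
        have := h ⟨i, by simpa using hN hi⟩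
        simpa [hi] using this
    · intro i hi; simp [hi]
  · intro i _ hi; simp [hi]

lemma bern_shift {𝒜 : Type*} [MeasurableSpace 𝒜] {p : Measure 𝒜} [IsProbabilityMeasure p]
    {ℙ : Measure (ℕ → 𝒜)} (hPr : IsBernoulli p ℙ) :
    ℙ.map (fun ω n => ω (n+1)) = ℙ := by
  rw [Measure.eq_infinitePi (μ := fun _ : ℕ => p) (ν := ℙ) (bern_pi hPr)]
  apply Measure.eq_infinitePi
  intro s t ht
  rw [← Measure.eq_infinitePi (μ := fun _ : ℕ => p) (ν := ℙ) (bern_pi hPr)]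
  rw [Measure.map_apply (by fun_prop) (MeasurableSet.pi s.countable_toSet fun i _ => ht i)]
  have := bern_pi hPr (s.map ⟨Nat.succ, Nat.succ_injective⟩) (fun i => t (i-1)) (fun i => ht _)
  rw [Finset.prod_map] at this
  refine Eq.trans ?_ this
  congr 1
  ext ω
  simp [Set.mem_pi]

lemma meas_fib {𝒜 : Type*} [Countable 𝒜] [MeasurableSpace 𝒜] [MeasurableSingletonClass 𝒜]
    (f : 𝒜 → ℝ → ℝ) (hfm : ∀ c, Measurable (f c)) (x : ℝ) (n : ℕ) :
    Measurable fun ω : ℕ → 𝒜 => fib f ω n x := by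
  induction n with
  | zero => exact measurable_const
  | succ n ih =>
    have h : Measurable fun q : 𝒜 × ℝ => f q.1 q.2 := measurable_from_prod_countable_right hfm
    exact h.comp ((measurable_pi_apply n).prodMk ih)

lemma fib_shift {𝒜 : Type*} (f : 𝒜 → ℝ → ℝ) (ω : ℕ → 𝒜) (x : ℝ) (n : ℕ) :
    fib f ω (n+1) x = fib f (fun k => ω (k+1)) n (f (ω 0) x) := by
  induction n with
  | zero => rfl
  | succ n ih =>
    change f (ω (n+1)) (fib f ω (n+1) x) = f (ω (n+1)) _
    rw [ih]

lemma const_of_loc {Y : Type*} (u : ℝ → Y)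
    (hloc : ∀ z ∈ Ioo (0:ℝ) 1, ∀ᶠ y in nhds z, u y = u z) :
    ∀ x ∈ Ioo (0:ℝ) 1, ∀ y ∈ Ioo (0:ℝ) 1, u x = u y := by
  letI : TopologicalSpace Y := ⊥
  haveI : DiscreteTopology Y := ⟨rfl⟩
  intro x hx y hy
  refine isPreconnected_Ioo.constant (f := u) ?_ hx hy
  intro z hz
  refine Filter.Tendsto.mono_left ?_ nhdsWithin_le_nhds
  exact (tendsto_pure.2 (hloc z hz)).mono_right (pure_le_nhds _)

lemma core {𝒜 : Type*} [Countable 𝒜] [MeasurableSpace 𝒜] [MeasurableSingletonClass 𝒜]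
    (p : Measure 𝒜) [IsProbabilityMeasure p] (hp : ∀ c : 𝒜, 0 < p {c})
    (ℙ : Measure (ℕ → 𝒜)) [IsProbabilityMeasure ℙ] (hPr : IsBernoulli p ℙ)
    (f : 𝒜 → ℝ → ℝ) (hfm : ∀ c, Measurable (f c))
    (hH0 : ∀ x ∈ Ioo (0:ℝ) 1, TailTrivial ℙ fun n ω => fib f ω n x)
    (hH1 : ∀ c, MapsTo (f c) (Ioo (0:ℝ) 1) (Ioo (0:ℝ) 1) ∧ MonotoneOn (f c) (Ioo (0:ℝ) 1))
    (hH2 : ∀ x ∈ Ioo (0:ℝ) 1, ∃ a b : 𝒜, f a x < x ∧ x < f b x)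
    (ψ : ℝ → ℝ) (C : ℝ) (hC : ∀ t, |ψ t| ≤ C) (hψ : Monotone ψ ∨ Antitone ψ) :
    ∃ u : ℝ, ∀ x ∈ Ioo (0:ℝ) 1, ∀ᵐ ω ∂ℙ,
      limsup (avg fun j => ψ (fib f ω j x)) atTop = u := by
  have hψm : Measurable ψ := hψ.elim Monotone.measurable Antitone.measurable
  -- existence for each x
  have h1 : ∀ x ∈ Ioo (0:ℝ) 1, ∃ u : ℝ, ∀ᵐ ω ∂ℙ,
      limsup (avg fun j => ψ (fib f ω j x)) atTop = u := by
    intro x hx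
    have hm : Measurable fun ω : ℕ → 𝒜 => limsup (avg fun j => ψ (fib f ω j x)) atTop :=
      meas_limsup (fun n ω => ψ (fib f ω n x)) (fun n ω => hC _) 0
        fun n _ => hψm.comp (meas_fib f hfm x n)
    refine Filter.exists_eventuallyEq_const_of_forall_separating MeasurableSet fun U hU => ?_
    have := hH0 x hx ((fun ω : ℕ → 𝒜 => limsup (avg fun j => ψ (fib f ω j x)) atTop) ⁻¹' U) ?_
    · rcases this with h | h
      · right
        exact measure_eq_zero_iff_ae_notMem.1 h
      · left
        exact (prob_compl_eq_zero_iff (hm hU)).2 h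
    · rw [MeasurableSpace.measurableSet_iInf]
      intro m
      refine @meas_limsup _ (⨆ (n : ℕ) (_ : m ≤ n), MeasurableSpace.comap
        (fun ω : ℕ → 𝒜 => fib f ω n x) inferInstance) (fun n ω => ψ (fib f ω n x)) C
        (fun n ω => hC _) m (fun n hn => ?_) U hU
      refine hψm.comp ?_
      refine Measurable.mono (comap_measurable (fun ω : ℕ → 𝒜 => fib f ω n x)) ?_ le_rfl
      exact le_iSup₂_of_le n hn le_rfl
  choose! u hu using h1
  have h2 : ∀ x ∈ Ioo (0:ℝ) 1, ∀ a, u (f a x) = u x := by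
    intro x hx a
    have hy := (hH1 a).1 hx
    have e1 := hu x hx
    have e2 := hu _ hy
    rw [← bern_shift hPr] at e2
    have e2 := ae_of_ae_map (Measurable.aemeasurable (by fun_prop)) e2
    have pos : ℙ {ω | ω 0 = a} ≠ 0 := by
      have := hPr 1 (fun _ => {a}) (fun _ => measurableSet_singleton a)
      simp at this
      rw [this]
      exact (hp a).ne'
    obtain ⟨ω, h0, ha, hb⟩ := (frequently_ae_iff.2 pos).and_eventually (e1.and e2) |>.exists
    have h3 := limsup_avg_succ (y := fun j => ψ (fib f ω j x)) fun n => hC _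
    simp only [fib_shift] at h3
    rw [h0] at h3
    rw [← ha, ← hb, h3]
  have hfib : ∀ ω n, MapsTo (fib f ω n) (Ioo (0:ℝ) 1) (Ioo (0:ℝ) 1) ∧
      MonotoneOn (fib f ω n) (Ioo (0:ℝ) 1) := by
    intro ω n
    induction n with
    | zero => exact ⟨mapsTo_id _, monotoneOn_id⟩
    | succ n ih =>
      exact ⟨(hH1 _).1.comp ih.1, (hH1 _).2.comp ih.2 ih.1⟩
  have hgen : ∀ x ∈ Ioo (0:ℝ) 1, ∀ y ∈ Ioo (0:ℝ) 1,
      (∀ ω n, ψ (fib f ω n x) ≤ ψ (fib f ω n y)) → u x ≤ u y := by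
    intro x hx y hy h
    obtain ⟨ω, ha, hb⟩ := ((hu x hx).and (hu y hy)).exists
    rw [← ha, ← hb]
    refine limsup_le_limsup (Eventually.of_forall fun n => ?_)
      (bdd_ge (abs_avg_le fun n => hC _)).isCoboundedUnder_le (bdd_le (abs_avg_le fun n => hC _))
    exact mul_le_mul_of_nonneg_left (Finset.sum_le_sum fun i _ => h ω i) (by positivity)
  have hmono : MonotoneOn u (Ioo (0:ℝ) 1) ∨ AntitoneOn u (Ioo (0:ℝ) 1) := by
    rcases hψ with h | h
    · exact .inl fun x hx y hy hxy => hgen x hx y hy fun ω n => h ((hfib ω n).2 hx hy hxy)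
    · exact .inr fun x hx y hy hxy => hgen y hy x hx fun ω n => h ((hfib ω n).2 hx hy hxy)
  have hloc : ∀ z ∈ Ioo (0:ℝ) 1, ∀ᶠ y in nhds z, u y = u z := by
    intro z hz
    obtain ⟨a, b, ha, hb⟩ := hH2 z hz
    have A := (hH1 a).1 hz
    have B := (hH1 b).1 hz
    filter_upwards [Ioo_mem_nhds ha hb] with y hy
    have hy' : y ∈ Ioo (0:ℝ) 1 := ⟨A.1.trans hy.1, hy.2.trans B.2⟩
    rcases hmono with h | h
    · have c1 := h A hy' hy.1.le
      have c2 := h hy' B hy.2.le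
      rw [h2 z hz] at c1 c2
      exact le_antisymm c2 c1
    · have c1 := h A hy' hy.1.le
      have c2 := h hy' B hy.2.le
      rw [h2 z hz] at c1 c2
      exact le_antisymm c1 c2
  have hhalf : (1/2 : ℝ) ∈ Ioo (0:ℝ) 1 := by norm_num
  refine ⟨u (1/2), fun x hx => ?_⟩
  have : u x = u (1/2) := by
    exact const_of_loc u hloc x hx (1/2) hhalf
  rw [← this]
  exact hu x hx

theorem statement9 {𝒜 : Type*} [Countable 𝒜] [MeasurableSpace 𝒜] [MeasurableSingletonClass 𝒜]
    (p : Measure 𝒜) [IsProbabilityMeasure p] (hp : ∀ c : 𝒜, 0 < p {c})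
    (ℙ : Measure (ℕ → 𝒜)) [IsProbabilityMeasure ℙ] (hPr : IsBernoulli p ℙ)
    (f : 𝒜 → ℝ → ℝ) (hfm : ∀ c, Measurable (f c))
    (hfI : ∀ c, MapsTo (f c) (Icc (0:ℝ) 1) (Icc (0:ℝ) 1))
    (hH0 : ∀ x ∈ Ioo (0:ℝ) 1, TailTrivial ℙ fun n ω => fib f ω n x)
    (hH1 : ∀ c, MapsTo (f c) (Ioo (0:ℝ) 1) (Ioo (0:ℝ) 1) ∧ MonotoneOn (f c) (Ioo (0:ℝ) 1))
    (hH2 : ∀ x ∈ Ioo (0:ℝ) 1, ∃ a b : 𝒜, f a x < x ∧ x < f b x)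
    (φ : ℝ → ℝ) (hφ : MonotoneOn φ (Icc (0:ℝ) 1)) :
    ∃ u l : ℝ, ∀ x ∈ Ioo (0:ℝ) 1, ∀ᵐ ω ∂ℙ,
      Filter.limsup
        (fun n : ℕ => (n:ℝ)⁻¹ * ∑ j ∈ Finset.range n, φ (fib f ω j x)) atTop = u ∧
      Filter.liminf
        (fun n : ℕ => (n:ℝ)⁻¹ * ∑ j ∈ Finset.range n, φ (fib f ω j x)) atTop = l := by
  let ψ : ℝ → ℝ := fun t => φ (projIcc 0 1 zero_le_one t)
  have hψ : Monotone ψ := fun s t h =>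
    hφ (Subtype.prop _) (Subtype.prop _) (monotone_projIcc zero_le_one h)
  have hC : ∀ t, |ψ t| ≤ max |φ 0| |φ 1| := by
    intro t
    have hz := (projIcc (0:ℝ) 1 zero_le_one t).2
    exact abs_le_max_abs_abs (hφ (by simp) hz hz.1) (hφ hz (by simp) hz.2)
  obtain ⟨u, hu⟩ := core p hp ℙ hPr f hfm hH0 hH1 hH2 ψ _ hC (.inl hψ)
  obtain ⟨l, hl⟩ := core p hp ℙ hPr f hfm hH0 hH1 hH2 (fun t => - ψ t) _
    (fun t => by rw [abs_neg]; exact hC t) (.inr hψ.neg)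
  refine ⟨u, -l, fun x hx => ?_⟩
  filter_upwards [hu x hx, hl x hx] with ω h1 h2
  have hmem : ∀ n, fib f ω n x ∈ Icc (0:ℝ) 1 := by
    intro n
    induction n with
    | zero => exact Ioo_subset_Icc_self hx
    | succ n ih => exact hfI _ ih
  have e : ∀ n, ψ (fib f ω n x) = φ (fib f ω n x) := fun n => by
    simp only [ψ, projIcc_of_mem zero_le_one (hmem n)]
  simp only [e] at h1 h2
  refine ⟨h1, ?_⟩
  rw [liminf_eq_neg, ← h2]
  congr 2
  ext n
  simp [avg]
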